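/- arXiv:2510.10979 — 3 statements merged into one kernel-verified Lean document; each statement's English description precedes it below -/
import Mathlib

section
/- Let φ, θ, ψ ∈ ℝ with cos θ > 0 and −π/2 < ψ < π/2, and let (q_w, q_x, q_y, q_z) be the quaternion obtained from the Z-Y-X Euler angles (φ, θ, ψ) by the half-angle conversion formulas. Then the heading-extraction formula is exact: arctan( 2(q_w q_z + q_x q_y) / (1 − 2(q_y² + q_z²)) ) = ψ, and in particular the denominator 1 − 2(q_y² + q_z²) is strictly positive. -/
open Real in
/-- Scalar part of the quaternion obtained from Z-Y-X Euler angles (roll φ, pitch θ, heading ψ). -/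
noncomputable def eulerQw (φ θ ψ : ℝ) : ℝ :=
  cos (φ / 2) * cos (θ / 2) * cos (ψ / 2) + sin (φ / 2) * sin (θ / 2) * sin (ψ / 2)

open Real in
/-- i-part of the quaternion obtained from Z-Y-X Euler angles. -/
noncomputable def eulerQx (φ θ ψ : ℝ) : ℝ :=
  sin (φ / 2) * cos (θ / 2) * cos (ψ / 2) - cos (φ / 2) * sin (θ / 2) * sin (ψ / 2)

open Real in
/-- j-part of the quaternion obtained from Z-Y-X Euler angles. -/
noncomputable def eulerQy (φ θ ψ : ℝ) : ℝ :=
  cos (φ / 2) * sin (θ / 2) * cos (ψ / 2) + sin (φ / 2) * cos (θ / 2) * sin (ψ / 2)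

open Real in
/-- k-part of the quaternion obtained from Z-Y-X Euler angles. -/
noncomputable def eulerQz (φ θ ψ : ℝ) : ℝ :=
  cos (φ / 2) * cos (θ / 2) * sin (ψ / 2) - sin (φ / 2) * sin (θ / 2) * cos (ψ / 2)

theorem two_mul_eulerQw_mul_eulerQz_add (φ θ ψ : ℝ) :
    2 * (eulerQw φ θ ψ * eulerQz φ θ ψ + eulerQx φ θ ψ * eulerQy φ θ ψ) =
      Real.cos θ * Real.sin ψ := by
  have hcos : Real.cos θ = Real.cos (θ / 2) ^ 2 - Real.sin (θ / 2) ^ 2 := by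
    rw [← Real.cos_two_mul', mul_div_cancel₀ θ two_ne_zero]
  have hsin : Real.sin ψ = 2 * Real.sin (ψ / 2) * Real.cos (ψ / 2) := by
    rw [← Real.sin_two_mul, mul_div_cancel₀ ψ two_ne_zero]
  unfold eulerQw eulerQx eulerQy eulerQz
  rw [hcos, hsin]
  linear_combination 2 * Real.sin (ψ / 2) * Real.cos (ψ / 2) *
    (Real.cos (θ / 2) ^ 2 - Real.sin (θ / 2) ^ 2) * Real.sin_sq_add_cos_sq (φ / 2)

theorem one_sub_two_mul_eulerQy_sq_add (φ θ ψ : ℝ) :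
    1 - 2 * (eulerQy φ θ ψ ^ 2 + eulerQz φ θ ψ ^ 2) = Real.cos θ * Real.cos ψ := by
  have hcos (x : ℝ) : Real.cos x = Real.cos (x / 2) ^ 2 - Real.sin (x / 2) ^ 2 := by
    rw [← Real.cos_two_mul', mul_div_cancel₀ x two_ne_zero]
  unfold eulerQy eulerQz
  rw [hcos θ, hcos ψ]
  linear_combination
    -2 * (Real.sin (θ / 2) ^ 2 * Real.cos (ψ / 2) ^ 2 +
      Real.cos (θ / 2) ^ 2 * Real.sin (ψ / 2) ^ 2) * Real.sin_sq_add_cos_sq (φ / 2) -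
    (Real.sin (ψ / 2) ^ 2 + Real.cos (ψ / 2) ^ 2) * Real.sin_sq_add_cos_sq (θ / 2) -
    Real.sin_sq_add_cos_sq (ψ / 2)

/-- Under nonsingular attitude (`cos θ > 0`, `−π/2 < ψ < π/2`), the heading-extraction
formula is exact, and the denominator `1 − 2(q_y² + q_z²)` is strictly positive. -/
theorem euler_heading_extraction (φ θ ψ : ℝ) (hθ : 0 < Real.cos θ)
    (hψ₁ : -(Real.pi / 2) < ψ) (hψ₂ : ψ < Real.pi / 2) :
    Real.arctan (2 * (eulerQw φ θ ψ * eulerQz φ θ ψ + eulerQx φ θ ψ * eulerQy φ θ ψ)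
        / (1 - 2 * (eulerQy φ θ ψ ^ 2 + eulerQz φ θ ψ ^ 2))) = ψ
    ∧ 0 < 1 - 2 * (eulerQy φ θ ψ ^ 2 + eulerQz φ θ ψ ^ 2) := by
  have hψ : 0 < Real.cos ψ := Real.cos_pos_of_mem_Ioo ⟨hψ₁, hψ₂⟩
  rw [two_mul_eulerQw_mul_eulerQz_add, one_sub_two_mul_eulerQy_sq_add]
  refine ⟨?_, mul_pos hθ hψ⟩
  rw [mul_div_mul_left _ _ hθ.ne', ← Real.tan_eq_sin_div_cos, Real.arctan_tan hψ₁ hψ₂]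
end

section
/- Let g ∈ ℝ and let q = (q_w, q_x, q_y, q_z) ∈ ℝ⁴ satisfy q_w² + q_x² + q_y² + q_z² = 1. Then the determinant of the 4×4 matrix A₁(q, g) equals −32 g³ (q_w q_z + q_x q_y). -/
/-- The 4×4 matrix A₁(q, g) built from rows {1,2,3,4} of the observability matrix. -/
def A1 (qw qx qy qz g : ℝ) : Matrix (Fin 4) (Fin 4) ℝ :=
  !![-2*g*qy, 2*g*qz, -2*g*qw, 2*g*qx;
     2*g*qx, 2*g*qw, 2*g*qz, 2*g*qy;
     2*g*qw, -2*g*qx, -2*g*qy, 2*g*qz;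
     2*qw - qy, 2*qx + qz, -2*qy - qw, -2*qz + qx]

/-- For a unit quaternion, `det A₁(q, g) = −32 g³ (q_w q_z + q_x q_y)`. -/
theorem det_A1 (g qw qx qy qz : ℝ) (hq : qw^2 + qx^2 + qy^2 + qz^2 = 1) :
    (A1 qw qx qy qz g).det = -32 * g^3 * (qw*qz + qx*qy) := by
  have hdet : (A1 qw qx qy qz g).det =
      -32 * g^3 * (qw*qz + qx*qy) * (qw^2 + qx^2 + qy^2 + qz^2) := by
    simp [A1, Matrix.det_succ_row_zero, Fin.sum_univ_succ, Fin.succAbove]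
    ring
  rw [hdet, hq, mul_one]
end

section
/- Let g ∈ ℝ and let q = (q_w, q_x, q_y, q_z) ∈ ℝ⁴ satisfy q_w² + q_x² + q_y² + q_z² = 1. Then the determinant of the 4×4 matrix A₂(q, g) equals 16 g³ (1 − 2q_w² − 2q_y²). -/
/-- The 4×4 matrix A₂(q, g) built from rows {1,2,3,5} of the observability matrix. -/
def A2 (qw qx qy qz g : ℝ) : Matrix (Fin 4) (Fin 4) ℝ :=
  !![-2*g*qy, 2*g*qz, -2*g*qw, 2*g*qx;
     2*g*qx, 2*g*qw, 2*g*qz, 2*g*qy;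
     2*g*qw, -2*g*qx, -2*g*qy, 2*g*qz;
     -2*qz + qx, 2*qy + qw, 2*qx + qz, -2*qw + qy]

/-- For a unit quaternion, `det A₂(q, g) = 16 g³ (1 − 2q_w² − 2q_y²)`. -/
theorem det_A2 (g qw qx qy qz : ℝ) (hq : qw^2 + qx^2 + qy^2 + qz^2 = 1) :
    (A2 qw qx qy qz g).det = 16 * g^3 * (1 - 2*qw^2 - 2*qy^2) := by
  simp [A2, Matrix.det_succ_row_zero, Fin.sum_univ_succ, Fin.succAbove]
  linear_combination -16 * g^3 * (qw^2 + qy^2 - qx^2 - qz^2 - 1) * hq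
end
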